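/- Let V be a mixed lattice vector space equipped with a vector topology τ. Then: (i) τ is locally symmetric-solid if and only if τ is locally (≤)-full and the mixed lattice operations are continuous at zero (i.e., (x,y) ↦ x⌣y and (x,y) ↦ x⌢y are continuous at (0,0)); (ii) if τ is locally symmetric-solid then the mixed lattice operations are uniformly continuous; (iii) if the mixed lattice operations are uniformly continuous then τ is locally mixed-full and the mixed lattice operations are continuous at zero. -/

import Mathlib

/-- A mixed lattice vector space: a real vector space with two partial orders
(the initial order `le` and the specific order `sle`), each making it a partially
ordered vector space, such that the mixed upper and lower envelopes `up` and `down`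
exist, `sle` implies `le`, and the specific cone is a mixed lattice cone. -/
structure MixedLattice (V : Type*) [AddCommGroup V] [Module ℝ V] where
  le : V → V → Prop
  sle : V → V → Prop
  le_refl : ∀ x, le x x
  le_trans : ∀ {x y z}, le x y → le y z → le x z
  le_antisymm : ∀ {x y}, le x y → le y x → x = y
  sle_refl : ∀ x, sle x x
  sle_trans : ∀ {x y z}, sle x y → sle y z → sle x z
  sle_antisymm : ∀ {x y}, sle x y → sle y x → x = y
  le_add : ∀ {x y} (z : V), le x y → le (x + z) (y + z)
  le_smul : ∀ {a : ℝ}, 0 ≤ a → ∀ {x y}, le x y → le (a • x) (a • y)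
  sle_add : ∀ {x y} (z : V), sle x y → sle (x + z) (y + z)
  sle_smul : ∀ {a : ℝ}, 0 ≤ a → ∀ {x y}, sle x y → sle (a • x) (a • y)
  /-- the mixed upper envelope `x ⌣ y` -/
  up : V → V → V
  /-- the mixed lower envelope `x ⌢ y` -/
  down : V → V → V
  up_mem₁ : ∀ x y, sle x (up x y)
  up_mem₂ : ∀ x y, le y (up x y)
  up_min : ∀ x y w, sle x w → le y w → le (up x y) w
  down_mem₁ : ∀ x y, sle (down x y) x
  down_mem₂ : ∀ x y, le (down x y) y
  down_max : ∀ x y w, sle w x → le w y → le w (down x y)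
  sle_imp_le : ∀ {x y}, sle x y → le x y
  up_cone : ∀ {x y}, sle 0 x → sle 0 y → sle 0 (up x y)
  down_cone : ∀ {x y}, sle 0 x → sle 0 y → sle 0 (down x y)

namespace MixedLattice

variable {V : Type*} [AddCommGroup V] [Module ℝ V] (M : MixedLattice V)

/-- the specific upper part `xᵘ = 0 ⌣ x` -/
def supp (x : V) : V := M.up 0 x

/-- the specific lower part `xˡ = 0 ⌣ (-x)` -/
def slowp (x : V) : V := M.up 0 (-x)

/-- the upper part `ᵘx = x ⌣ 0` -/
def upp (x : V) : V := M.up x 0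

/-- the lower part `ˡx = (-x) ⌣ 0` -/
def lowp (x : V) : V := M.up (-x) 0

/-- the symmetric generalized absolute value `s(x) = (1/2)((x⌣(−x)) + ((−x)⌣x))` -/
noncomputable def sabs (x : V) : V := (1 / 2 : ℝ) • (M.up x (-x) + M.up (-x) x)

/-- the type 1 mixed-full hull `MF₁(A) = {y : x ≼ y ≤ z for some x, z ∈ A}` -/
def MF1 (A : Set V) : Set V := {y | ∃ x ∈ A, ∃ z ∈ A, M.sle x y ∧ M.le y z}

/-- the type 2 mixed-full hull `MF₂(A) = {y : x ≤ y ≼ z for some x, z ∈ A}` -/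
def MF2 (A : Set V) : Set V := {y | ∃ x ∈ A, ∃ z ∈ A, M.le x y ∧ M.sle y z}

/-- `MS₁(A) = {y : −s(x) ≼ y ≤ s(x) for some x ∈ A}` -/
def MS1 (A : Set V) : Set V := {y | ∃ x ∈ A, M.sle (-M.sabs x) y ∧ M.le y (M.sabs x)}

/-- `MS₂(A) = {y : −s(x) ≤ y ≼ s(x) for some x ∈ A}` -/
def MS2 (A : Set V) : Set V := {y | ∃ x ∈ A, M.le (-M.sabs x) y ∧ M.sle y (M.sabs x)}

/-- a set is symmetric-solid if `x ∈ A` and `s(y) ≤ s(x)` imply `y ∈ A` -/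
def SymmSolid (A : Set V) : Prop := ∀ x ∈ A, ∀ y, M.le (M.sabs y) (M.sabs x) → y ∈ A

/-- a set is (≤)-full if `x, y ∈ S` and `y ≤ z ≤ x` imply `z ∈ S` -/
def LeFull (S : Set V) : Prop := ∀ x ∈ S, ∀ y ∈ S, ∀ z, M.le y z → M.le z x → z ∈ S

/-- a set is (≼)-full if `x, y ∈ S` and `y ≼ z ≼ x` imply `z ∈ S` -/
def SleFull (S : Set V) : Prop := ∀ x ∈ S, ∀ y ∈ S, ∀ z, M.sle y z → M.sle z x → z ∈ S

/-- a linear subspace, as a set -/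
def IsSubspace (S : Set V) : Prop :=
  (0 : V) ∈ S ∧ (∀ x ∈ S, ∀ y ∈ S, x + y ∈ S) ∧ ∀ (a : ℝ), ∀ x ∈ S, a • x ∈ S

/-- a mixed lattice subspace -/
def IsMLSubspace (S : Set V) : Prop :=
  IsSubspace S ∧ ∀ x ∈ S, ∀ y ∈ S, M.up x y ∈ S ∧ M.down x y ∈ S

section Topology

variable [TopologicalSpace V]

/-- uniform continuity of a map `V → V` with respect to a vector topology -/
def UnifCont (f : V → V) : Prop :=
  ∀ W ∈ nhds (0 : V), ∃ U ∈ nhds (0 : V), ∀ x y : V, x - y ∈ U → f x - f y ∈ W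

/-- uniform continuity of a map `V × V → V` with respect to a vector topology -/
def UnifCont2 (g : V → V → V) : Prop :=
  ∀ W ∈ nhds (0 : V), ∃ U ∈ nhds (0 : V),
    ∀ x x' y y' : V, x - x' ∈ U → y - y' ∈ U → g x y - g x' y' ∈ W

/-- the topology is locally mixed-full: every neighborhood of zero contains a
type 1 mixed-full neighborhood of zero -/
def LocallyMixedFull : Prop :=
  ∀ U ∈ nhds (0 : V), ∃ W ∈ nhds (0 : V), W ⊆ U ∧ M.MF1 W = W

/-- the topology has a neighborhood base at zero of symmetric-solid sets -/
def LocallySymmSolid : Prop :=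
  ∀ U ∈ nhds (0 : V), ∃ W ∈ nhds (0 : V), W ⊆ U ∧ M.SymmSolid W

/-- the topology has a neighborhood base at zero of (≤)-full sets -/
def LocallyLeFull : Prop :=
  ∀ U ∈ nhds (0 : V), ∃ W ∈ nhds (0 : V), W ⊆ U ∧ M.LeFull W

/-- the mixed lattice operations are continuous at zero -/
def ContAtZero : Prop :=
  ContinuousAt (fun p : V × V => M.up p.1 p.2) ((0 : V), (0 : V)) ∧
  ContinuousAt (fun p : V × V => M.down p.1 p.2) ((0 : V), (0 : V))

end Topology

end MixedLattice

namespace MixedLattice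

section Order

variable {V : Type*} [AddCommGroup V] [Module ℝ V] (M : MixedLattice V)

lemma add_le_add' {a b c d : V} (h₁ : M.le a b) (h₂ : M.le c d) : M.le (a + c) (b + d) := by
  refine M.le_trans (M.le_add c h₁) ?_
  simpa only [add_comm] using M.le_add b h₂

lemma add_sle_add' {a b c d : V} (h₁ : M.sle a b) (h₂ : M.sle c d) :
    M.sle (a + c) (b + d) := by
  refine M.sle_trans (M.sle_add c h₁) ?_
  simpa only [add_comm] using M.sle_add b h₂

lemma neg_le_neg' {a b : V} (h : M.le a b) : M.le (-b) (-a) := by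
  have := M.le_add (-a - b) h
  rwa [show a + (-a - b) = -b by abel, show b + (-a - b) = -a by abel] at this

lemma neg_sle_neg' {a b : V} (h : M.sle a b) : M.sle (-b) (-a) := by
  have := M.sle_add (-a - b) h
  rwa [show a + (-a - b) = -b by abel, show b + (-a - b) = -a by abel] at this

lemma up_add_right_le (x y z : V) : M.le (M.up (x + z) (y + z)) (M.up x y + z) :=
  M.up_min _ _ _ (M.sle_add z (M.up_mem₁ x y)) (M.le_add z (M.up_mem₂ x y))

lemma up_add_right (x y z : V) : M.up (x + z) (y + z) = M.up x y + z := by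
  refine M.le_antisymm (M.up_add_right_le x y z) ?_
  simpa using M.le_add z (M.up_add_right_le (x + z) (y + z) (-z))

lemma up_eq (x y : V) : M.up x y = M.up 0 (y - x) + x := by
  simpa using M.up_add_right 0 (y - x) x

lemma up_zero_zero : M.up 0 0 = 0 :=
  M.le_antisymm (M.up_min _ _ _ (M.sle_refl 0) (M.le_refl 0)) (M.up_mem₂ 0 0)

lemma down_eq_neg_up_neg (x y : V) : M.down x y = -M.up (-x) (-y) := by
  refine M.le_antisymm ?_ (M.down_max _ _ _ ?_ ?_)
  · simpa using M.neg_le_neg' (M.up_min (-x) (-y) (-M.down x y)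
      (M.neg_sle_neg' (M.down_mem₁ x y)) (M.neg_le_neg' (M.down_mem₂ x y)))
  · simpa using M.neg_sle_neg' (M.up_mem₁ (-x) (-y))
  · simpa using M.neg_le_neg' (M.up_mem₂ (-x) (-y))

lemma down_eq (x y : V) : M.down x y = x - M.up 0 (x - y) := by
  rw [down_eq_neg_up_neg, up_eq, show -y - -x = x - y by abel]
  abel

lemma up_zero_mono {x y : V} (h : M.le x y) : M.le (M.up 0 x) (M.up 0 y) :=
  M.up_min _ _ _ (M.up_mem₁ 0 y) (M.le_trans h (M.up_mem₂ 0 y))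

lemma up_zero_add_le (x y : V) : M.le (M.up 0 (x + y)) (M.up 0 x + M.up 0 y) := by
  refine M.up_min _ _ _ ?_ (M.add_le_add' (M.up_mem₂ 0 x) (M.up_mem₂ 0 y))
  simpa using M.add_sle_add' (M.up_mem₁ 0 x) (M.up_mem₁ 0 y)

lemma up_zero_of_zero_sle {x : V} (h : M.sle 0 x) : M.up 0 x = x :=
  M.le_antisymm (M.up_min _ _ _ h (M.le_refl x)) (M.up_mem₂ 0 x)

lemma up_zero_of_le_zero {x : V} (h : M.le x 0) : M.up 0 x = 0 :=
  M.le_antisymm (M.up_min _ _ _ (M.sle_refl 0) h) (M.sle_imp_le (M.up_mem₁ 0 x))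

lemma up_zero_add_self (x : V) : M.up 0 (x + x) = M.up 0 x + M.up 0 x := by
  have two_halves (v : V) : (1 / 2 : ℝ) • (v + v) = v := by
    rw [← two_smul ℝ v, smul_smul]; norm_num
  have h₁ : M.sle 0 ((1 / 2 : ℝ) • M.up 0 (x + x)) := by
    simpa using M.sle_smul (a := 1 / 2) (by norm_num) (M.up_mem₁ 0 (x + x))
  have h₂ : M.le x ((1 / 2 : ℝ) • M.up 0 (x + x)) := by
    simpa only [two_halves] using
      M.le_smul (a := 1 / 2) (by norm_num) (M.up_mem₂ 0 (x + x))
  have h₃ := M.up_min _ _ _ h₁ h₂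
  have h₄ := M.add_le_add' h₃ h₃
  rw [← smul_add, two_halves] at h₄
  exact M.le_antisymm (M.up_zero_add_le x x) h₄

lemma sabs_eq (x : V) : M.sabs x = M.up 0 x + M.up 0 (-x) := by
  rw [sabs, M.up_eq x (-x), M.up_eq (-x) x, show -x - x = -x + -x by abel,
    show x - -x = x + x by abel, up_zero_add_self, up_zero_add_self,
    show M.up 0 (-x) + M.up 0 (-x) + x + (M.up 0 x + M.up 0 x + -x)
      = (2 : ℝ) • (M.up 0 x + M.up 0 (-x)) by rw [two_smul]; abel, smul_smul]
  norm_num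

lemma zero_sle_sabs (x : V) : M.sle 0 (M.sabs x) := by
  rw [sabs_eq]
  simpa using M.add_sle_add' (M.up_mem₁ 0 x) (M.up_mem₁ 0 (-x))

lemma sabs_neg (x : V) : M.sabs (-x) = M.sabs x := by
  rw [sabs_eq, sabs_eq, neg_neg, add_comm]

lemma sabs_of_zero_sle {x : V} (h : M.sle 0 x) : M.sabs x = x := by
  rw [sabs_eq, M.up_zero_of_zero_sle h, M.up_zero_of_le_zero, add_zero]
  simpa using M.neg_le_neg' (M.sle_imp_le h)

lemma up_zero_le_sabs (x : V) : M.le (M.up 0 x) (M.sabs x) := by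
  rw [sabs_eq]
  simpa using M.add_le_add' (M.le_refl (M.up 0 x)) (M.sle_imp_le (M.up_mem₁ 0 (-x)))

lemma le_sabs (x : V) : M.le x (M.sabs x) :=
  M.le_trans (M.up_mem₂ 0 x) (M.up_zero_le_sabs x)

lemma neg_sabs_le (x : V) : M.le (-M.sabs x) x := by
  simpa [sabs_neg] using M.neg_le_neg' (M.le_sabs (-x))

lemma sabs_add_self (x : V) : M.sabs (x + x) = M.sabs x + M.sabs x := by
  rw [sabs_eq, sabs_eq, neg_add, up_zero_add_self, up_zero_add_self]
  abel

lemma sabs_le_of_le_of_le {a b y : V} (ha : M.le a y) (hb : M.le y b) :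
    M.le (M.sabs y) (M.sabs b + M.sabs a) := by
  rw [M.sabs_eq y]
  refine M.add_le_add' (M.le_trans (M.up_zero_mono hb) (M.up_zero_le_sabs b))
    (M.le_trans (M.up_zero_mono (M.neg_le_neg' ha)) ?_)
  simpa [sabs_neg] using M.up_zero_le_sabs (-a)

lemma up_zero_sub_le (x y : V) : M.le (M.up 0 x - M.up 0 y) (M.sabs (x - y)) := by
  have h := M.le_add (-M.up 0 y) (M.up_zero_add_le (x - y) y)
  rw [sub_add_cancel, add_neg_cancel_right, ← sub_eq_add_neg] at h
  exact M.le_trans h (M.up_zero_le_sabs _)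

/-- The map `x ↦ 0 ⌣ x` is Lipschitz for the symmetric absolute value. -/
lemma sabs_up_zero_sub_le (x y : V) :
    M.le (M.sabs (M.up 0 x - M.up 0 y)) (M.sabs ((x - y) + (x - y))) := by
  have h : M.le (-M.sabs (x - y)) (M.up 0 x - M.up 0 y) := by
    have := M.neg_le_neg' (M.up_zero_sub_le y x)
    rwa [neg_sub, ← neg_sub x y, sabs_neg] at this
  simpa only [sabs_neg, M.sabs_of_zero_sle (M.zero_sle_sabs _), sabs_add_self] using
    M.sabs_le_of_le_of_le h (M.up_zero_sub_le x y)

lemma down_eq_left {x y : V} (h : M.le x y) : M.down x y = x :=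
  M.le_antisymm (M.sle_imp_le (M.down_mem₁ x y)) (M.down_max _ _ _ (M.sle_refl x) h)

lemma down_eq_right {x y : V} (h : M.sle y x) : M.down x y = y :=
  M.le_antisymm (M.down_mem₂ x y) (M.down_max _ _ _ h (M.le_refl y))

lemma down_zero_zero : M.down 0 0 = 0 := M.down_eq_left (M.le_refl 0)

lemma subset_MF1 (A : Set V) : A ⊆ M.MF1 A :=
  fun x hx => ⟨x, hx, x, hx, M.sle_refl x, M.le_refl x⟩

lemma MF1_MF1 (A : Set V) : M.MF1 (M.MF1 A) = M.MF1 A := by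
  refine Set.Subset.antisymm ?_ (M.subset_MF1 _)
  rintro y ⟨x, ⟨a, ha, -, -, hax, -⟩, z, ⟨-, -, b, hb, -, hzb⟩, hxy, hyz⟩
  exact ⟨a, ha, b, hb, M.sle_trans hax hxy, M.le_trans hyz hzb⟩

end Order

section Topology

open Topology

variable {V : Type*} [AddCommGroup V] [TopologicalSpace V]

lemma exists_nhds_zero_add_mem [ContinuousAdd V] {U : Set V} (hU : U ∈ 𝓝 (0 : V)) :
    ∃ W ∈ 𝓝 (0 : V), ∀ x ∈ W, ∀ y ∈ W, x + y ∈ U := by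
  have h : Filter.Tendsto (fun p : V × V => p.1 + p.2) (𝓝 0 ×ˢ 𝓝 0) (𝓝 0) := by
    simpa [nhds_prod_eq] using (continuous_add (M := V)).tendsto (0, 0)
  obtain ⟨W, hW, hWU⟩ := Filter.mem_prod_same_iff.1 (h hU)
  exact ⟨W, hW, fun x hx y hy => hWU (Set.mk_mem_prod hx hy)⟩

lemma UnifCont2.continuousAt_zero {g : V → V → V} (hg : UnifCont2 g) (h0 : g 0 0 = 0) :
    ContinuousAt (fun p : V × V => g p.1 p.2) ((0 : V), (0 : V)) := by
  intro W hW
  simp only [h0] at hW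
  obtain ⟨U, hU, h⟩ := hg W hW
  refine Filter.mem_map.2 (Filter.mem_of_superset (prod_mem_nhds hU hU) fun p hp => ?_)
  rw [Set.mem_preimage]
  simpa [h0] using h p.1 0 p.2 0 (by simpa using hp.1) (by simpa using hp.2)

variable [Module ℝ V] (M : MixedLattice V)

lemma contAtZero_of_unifCont2 (h₁ : UnifCont2 M.up) (h₂ : UnifCont2 M.down) : M.ContAtZero :=
  ⟨h₁.continuousAt_zero M.up_zero_zero, h₂.continuousAt_zero M.down_zero_zero⟩

variable {M}

lemma LocallySymmSolid.locallyLeFull [ContinuousAdd V] (h : M.LocallySymmSolid) :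
    M.LocallyLeFull := by
  intro U hU
  obtain ⟨W, hW, hWU, hWs⟩ := h U hU
  obtain ⟨W', hW', hadd⟩ := exists_nhds_zero_add_mem hW
  obtain ⟨S, hS, hSW, hSs⟩ := h W' hW'
  have hsabs : ∀ x ∈ S, M.sabs x ∈ W' := fun x hx => hSW <| hSs x hx _ <| by
    rw [M.sabs_of_zero_sle (M.zero_sle_sabs x)]
    exact M.le_refl _
  refine ⟨{y | ∃ a ∈ S, ∃ b ∈ S, M.le a y ∧ M.le y b},
    Filter.mem_of_superset hS fun x hx => ⟨x, hx, x, hx, M.le_refl x, M.le_refl x⟩, ?_, ?_⟩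
  · rintro y ⟨a, ha, b, hb, hay, hyb⟩
    refine hWU (hWs _ (hadd _ (hsabs b hb) _ (hsabs a ha)) y ?_)
    rw [M.sabs_of_zero_sle (x := M.sabs b + M.sabs a)
      (by simpa using M.add_sle_add' (M.zero_sle_sabs b) (M.zero_sle_sabs a))]
    exact M.sabs_le_of_le_of_le hay hyb
  · rintro x ⟨-, -, b, hb, -, hxb⟩ y ⟨a, ha, -, -, hay, -⟩ z hyz hzx
    exact ⟨a, ha, b, hb, M.le_trans hay hyz, M.le_trans hzx hxb⟩

lemma LocallySymmSolid.unifCont_up_zero [ContinuousAdd V] (h : M.LocallySymmSolid) :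
    UnifCont (M.up 0) := by
  intro W hW
  obtain ⟨S, hS, hSW, hSs⟩ := h W hW
  obtain ⟨U, hU, hadd⟩ := exists_nhds_zero_add_mem hS
  exact ⟨U, hU, fun x y hxy =>
    hSW (hSs _ (hadd _ hxy _ hxy) _ (M.sabs_up_zero_sub_le x y))⟩

variable [ContinuousAdd V] [ContinuousSMul ℝ V]

lemma exists_nhds_zero_sub_mem {U : Set V} (hU : U ∈ 𝓝 (0 : V)) :
    ∃ W ∈ 𝓝 (0 : V), ∀ x ∈ W, ∀ y ∈ W, x - y ∈ U ∧ x + y ∈ U := by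
  obtain ⟨W, hW, hadd⟩ := exists_nhds_zero_add_mem hU
  have hneg : Filter.Tendsto (fun x : V => -x) (𝓝 0) (𝓝 0) := by
    simpa using (continuous_const_smul (-1 : ℝ) (T := V)).tendsto 0
  refine ⟨W ∩ (fun x => -x) ⁻¹' W, Filter.inter_mem hW (hneg hW), fun x hx y hy => ⟨?_, ?_⟩⟩
  · simpa [sub_eq_add_neg] using hadd x hx.1 (-y) hy.2
  · exact hadd x hx.1 y hy.1

lemma unifCont2_of_unifCont_up_zero (h : UnifCont (M.up 0)) :
    UnifCont2 M.up ∧ UnifCont2 M.down := by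
  have key : ∀ W ∈ 𝓝 (0 : V), ∃ U ∈ 𝓝 (0 : V), ∀ x x' y y' : V, x - x' ∈ U → y - y' ∈ U →
      M.up x y - M.up x' y' ∈ W ∧ M.down x y - M.down x' y' ∈ W := by
    intro W hW
    obtain ⟨A, hA, hAW⟩ := exists_nhds_zero_sub_mem hW
    obtain ⟨B, hB, hBA⟩ := h A hA
    obtain ⟨C, hC, hCB⟩ := exists_nhds_zero_sub_mem hB
    refine ⟨A ∩ C, Filter.inter_mem hA hC, fun x x' y y' hx hy => ⟨?_, ?_⟩⟩
    · have h₁ := hBA (y - x) (y' - x') (by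
        rw [show y - x - (y' - x') = (y - y') - (x - x') by abel]
        exact (hCB _ hy.2 _ hx.2).1)
      have h₂ := (hAW _ h₁ _ hx.1).2
      rw [M.up_eq x y, M.up_eq x' y']
      convert h₂ using 1
      abel
    · have h₁ := hBA (x - y) (x' - y') (by
        rw [show x - y - (x' - y') = (x - x') - (y - y') by abel]
        exact (hCB _ hx.2 _ hy.2).1)
      have h₂ := (hAW _ hx.1 _ h₁).1
      rw [M.down_eq x y, M.down_eq x' y']
      convert h₂ using 1
      abel
  constructor <;> intro W hW <;> obtain ⟨U, hU, hUW⟩ := key W hW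
  · exact ⟨U, hU, fun x x' y y' hx hy => (hUW x x' y y' hx hy).1⟩
  · exact ⟨U, hU, fun x x' y y' hx hy => (hUW x x' y y' hx hy).2⟩

lemma locallySymmSolid_of_locallyLeFull (hfull : M.LocallyLeFull) (hcont : M.ContAtZero) :
    M.LocallySymmSolid := by
  intro U hU
  obtain ⟨W, hW, hWU, hWf⟩ := hfull U hU
  have hneg : Filter.Tendsto (fun x : V => -x) (𝓝 0) (𝓝 0) := by
    simpa using (continuous_const_smul (-1 : ℝ) (T := V)).tendsto 0
  have hup : Filter.Tendsto (M.up 0) (𝓝 0) (𝓝 0) := by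
    have h₁ : Filter.Tendsto (fun p : V × V => M.up p.1 p.2) (𝓝 (0, 0)) (𝓝 0) := by
      simpa [ContinuousAt, up_zero_zero] using hcont.1
    have h₂ : Filter.Tendsto (fun x : V => ((0 : V), x)) (𝓝 0) (𝓝 (0, 0)) :=
      (Continuous.prodMk_right (0 : V)).tendsto 0
    exact h₁.comp h₂
  have hsabs : Filter.Tendsto M.sabs (𝓝 0) (𝓝 0) := by
    rw [funext M.sabs_eq]
    simpa using hup.add (hup.comp hneg)
  have hA : M.sabs ⁻¹' W ∩ (fun x => -M.sabs x) ⁻¹' W ∈ 𝓝 (0 : V) :=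
    Filter.inter_mem (hsabs hW) ((hneg.comp hsabs) hW)
  refine ⟨{y | ∃ x ∈ M.sabs ⁻¹' W ∩ (fun x => -M.sabs x) ⁻¹' W, M.le (M.sabs y) (M.sabs x)},
    Filter.mem_of_superset hA fun x hx => ⟨x, hx, M.le_refl _⟩, ?_, ?_⟩
  · rintro y ⟨x, hx, hyx⟩
    exact hWU (hWf _ hx.1 _ hx.2 y
      (M.le_trans (M.neg_le_neg' hyx) (M.neg_sabs_le y)) (M.le_trans (M.le_sabs y) hyx))
  · rintro x ⟨w, hw, hxw⟩ y hyx
    exact ⟨w, hw, M.le_trans hyx hxw⟩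

lemma locallyMixedFull_of_unifCont2_down (h : UnifCont2 M.down) : M.LocallyMixedFull := by
  intro U hU
  obtain ⟨A, hA, hAU⟩ := exists_nhds_zero_add_mem hU
  obtain ⟨B, hB, hBA⟩ := h A hA
  obtain ⟨C, hC, hCB⟩ := exists_nhds_zero_sub_mem hB
  refine ⟨M.MF1 (A ∩ C), Filter.mem_of_superset (Filter.inter_mem hA hC) (M.subset_MF1 _),
    ?_, M.MF1_MF1 _⟩
  rintro y ⟨x, hx, z, hz, hxy, hyz⟩
  have h₁ := hBA y y z x (by simpa using mem_of_mem_nhds hB) (hCB _ hz.2 _ hx.2).1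
  rw [M.down_eq_left hyz, M.down_eq_right hxy] at h₁
  simpa using hAU _ h₁ _ hx.1

end Topology

end MixedLattice

/-- (i) locally symmetric-solid ↔ locally (≤)-full with the mixed lattice
operations continuous at zero; (ii) locally symmetric-solid implies the mixed lattice
operations are uniformly continuous; (iii) uniform continuity of the mixed lattice
operations implies the topology is locally mixed-full and the operations are
continuous at zero. -/
theorem stmt_5 {V : Type*} [AddCommGroup V] [Module ℝ V] (M : MixedLattice V)
    [TopologicalSpace V] [ContinuousAdd V] [ContinuousSMul ℝ V] :
    (M.LocallySymmSolid ↔ (M.LocallyLeFull ∧ M.ContAtZero)) ∧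
    (M.LocallySymmSolid →
      MixedLattice.UnifCont2 M.up ∧ MixedLattice.UnifCont2 M.down) ∧
    ((MixedLattice.UnifCont2 M.up ∧ MixedLattice.UnifCont2 M.down) →
      M.LocallyMixedFull ∧ M.ContAtZero) := by
  have hunif : M.LocallySymmSolid →
      MixedLattice.UnifCont2 M.up ∧ MixedLattice.UnifCont2 M.down := fun h =>
    MixedLattice.unifCont2_of_unifCont_up_zero h.unifCont_up_zero
  refine ⟨⟨fun h => ⟨h.locallyLeFull, ?_⟩, fun h =>
    MixedLattice.locallySymmSolid_of_locallyLeFull h.1 h.2⟩, hunif, fun h =>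
    ⟨MixedLattice.locallyMixedFull_of_unifCont2_down h.2,
      M.contAtZero_of_unifCont2 h.1 h.2⟩⟩
  exact M.contAtZero_of_unifCont2 (hunif h).1 (hunif h).2
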